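/- arXiv:1501.02703 — 2 statements merged into one kernel-verified Lean document; each statement's English description precedes it below -/
import Mathlib

section
/- Let (X, d) be a metric space, μ a Borel measure on X, x ∈ X, and C ≥ 0 a constant such that μ(B̄(x, ρ)) ≤ C ρ² for every ρ > 0, where B̄(x, ρ) denotes the closed ball. Then lim_{r → 0⁺} (log(1/√r))^{-2} ∫_{{y : r ≤ d(x,y) ≤ √r}} d(x,y)^{-2} dμ(y) = 0. (This is precisely the vanishing of the energies ∫ |∇η_i|² dμ of the logarithmic cut-off functions η_i(y) = log(d(x,y)/r)/log(1/√r) used to excise point singularities in the stability inequality.) -/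
open MeasureTheory Filter

theorem aux_shell {X : Type*} [MetricSpace X] [MeasurableSpace X] [BorelSpace X]
    (μ : Measure X) (x : X) (C : ℝ)
    (hgrowth : ∀ ρ : ℝ, 0 < ρ → μ (Metric.closedBall x ρ) ≤ ENNReal.ofReal (C * ρ ^ 2))
    (s : ℝ) (hs : 0 < s) :
    (∫⁻ y in {y : X | s ≤ dist x y ∧ dist x y < s * Real.exp 1},
              ENNReal.ofReal (1 / dist x y ^ 2) ∂μ) ≤ ENNReal.ofReal (C * Real.exp 1 ^ 2) := by
  have hm : MeasurableSet {y : X | s ≤ dist x y ∧ dist x y < s * Real.exp 1} := by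
    apply MeasurableSet.inter
    · exact (isClosed_le continuous_const (continuous_const.dist continuous_id)).measurableSet
    · exact (isOpen_lt (continuous_const.dist continuous_id) continuous_const).measurableSet
  calc _ ≤ ∫⁻ y in {y : X | s ≤ dist x y ∧ dist x y < s * Real.exp 1},
              ENNReal.ofReal (1 / s ^ 2) ∂μ := by
        apply setLIntegral_mono' hm
        rintro y ⟨h1, h2⟩
        apply ENNReal.ofReal_le_ofReal
        gcongr
    _ = ENNReal.ofReal (1 / s ^ 2) * μ {y : X | s ≤ dist x y ∧ dist x y < s * Real.exp 1} := by
        rw [setLIntegral_const]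
    _ ≤ ENNReal.ofReal (1 / s ^ 2) * ENNReal.ofReal (C * (s * Real.exp 1) ^ 2) := by
        gcongr
        refine le_trans (measure_mono ?_) (hgrowth _ (by positivity))
        rintro y ⟨h1, h2⟩
        rw [Metric.mem_closedBall, dist_comm]
        exact h2.le
    _ = _ := by
        rw [← ENNReal.ofReal_mul (by positivity)]
        congr 1
        field_simp

theorem aux_sum {X : Type*} [MetricSpace X] [MeasurableSpace X] [BorelSpace X]
    (μ : Measure X) (x : X) (C : ℝ)
    (hgrowth : ∀ ρ : ℝ, 0 < ρ → μ (Metric.closedBall x ρ) ≤ ENNReal.ofReal (C * ρ ^ 2))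
    (s : ℝ) (hs : 0 < s) (n : ℕ) :
    (∫⁻ y in {y : X | s ≤ dist x y ∧ dist x y < s * Real.exp n},
              ENNReal.ofReal (1 / dist x y ^ 2) ∂μ) ≤ n * ENNReal.ofReal (C * Real.exp 1 ^ 2) := by
  induction n with
  | zero =>
    have : {y : X | s ≤ dist x y ∧ dist x y < s * Real.exp (0 : ℕ)} = ∅ := by
      ext y
      simp
    rw [this]
    simp
  | succ n ih =>
    have hsub : {y : X | s ≤ dist x y ∧ dist x y < s * Real.exp (n + 1 : ℕ)} ⊆
        {y : X | s ≤ dist x y ∧ dist x y < s * Real.exp n} ∪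
        {y : X | s * Real.exp n ≤ dist x y ∧ dist x y < s * Real.exp n * Real.exp 1} := by
      rintro y ⟨h1, h2⟩
      rcases lt_or_ge (dist x y) (s * Real.exp n) with h | h
      · exact Or.inl ⟨h1, h⟩
      · refine Or.inr ⟨h, ?_⟩
        rwa [mul_assoc, ← Real.exp_add, ← Nat.cast_succ]
    refine (lintegral_mono_set hsub).trans ((lintegral_union_le _ _ _).trans ?_)
    push_cast
    rw [add_mul, one_mul]
    exact add_le_add ih (aux_shell μ x C hgrowth _ (by positivity))

/-- Under the quadratic area-growth bound `μ(B̄(x,ρ)) ≤ C ρ²`, the renormalized energy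
of the logarithmic cut-off on the annulus `{r ≤ d(x,y) ≤ √r}` tends to `0` as `r → 0⁺`:
`(log(1/√r))⁻² ∫_{r ≤ d(x,y) ≤ √r} d(x,y)⁻² dμ(y) → 0`. -/
theorem stmt_9 {X : Type*} [MetricSpace X] [MeasurableSpace X] [BorelSpace X]
    (μ : Measure X) (x : X) (C : ℝ) (hC : 0 ≤ C)
    (hgrowth : ∀ ρ : ℝ, 0 < ρ → μ (Metric.closedBall x ρ) ≤ ENNReal.ofReal (C * ρ ^ 2)) :
    Tendsto
      (fun r : ℝ =>
        (Real.log (1 / Real.sqrt r))⁻¹ ^ 2 *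
          (∫⁻ y in {y : X | r ≤ dist x y ∧ dist x y ≤ Real.sqrt r},
              ENNReal.ofReal (1 / dist x y ^ 2) ∂μ).toReal)
      (nhdsWithin 0 (Set.Ioi 0)) (nhds 0) := by
  have hL : Tendsto (fun r : ℝ => Real.log (1 / Real.sqrt r)) (nhdsWithin 0 (Set.Ioi 0)) atTop := by
    have h1 : Tendsto (fun r : ℝ => -(Real.log r / 2)) (nhdsWithin 0 (Set.Ioi 0)) atTop :=
      tendsto_neg_atBot_atTop.comp
        (Real.tendsto_log_nhdsGT_zero.atBot_div_const (by norm_num))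
    refine h1.congr' ?_
    filter_upwards [self_mem_nhdsWithin] with r hr
    rw [one_div, Real.log_inv, Real.log_sqrt (le_of_lt hr)]
  have hlim : Tendsto (fun L : ℝ => L⁻¹ ^ 2 * ((L + 1) * (C * Real.exp 1 ^ 2))) atTop (nhds 0) := by
    have h0 : Tendsto (fun L : ℝ => (L⁻¹ + L⁻¹ ^ 2) * (C * Real.exp 1 ^ 2)) atTop (nhds 0) := by
      generalize C * Real.exp 1 ^ 2 = K
      have := (tendsto_inv_atTop_zero (𝕜 := ℝ))
      simpa using (this.add (this.pow 2)).mul_const K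
    refine h0.congr' ?_
    filter_upwards [eventually_gt_atTop 0] with L hL
    field_simp
  refine squeeze_zero' (Eventually.of_forall fun r => by positivity) ?_ (hlim.comp hL)
  filter_upwards [self_mem_nhdsWithin, hL.eventually_gt_atTop 0] with r hr hpos
  have hr : 0 < r := hr
  simp only [Function.comp]
  set L := Real.log (1 / Real.sqrt r) with hLdef
  have hs : Real.sqrt r = r * Real.exp L := by
    rw [hLdef, Real.exp_log (by positivity)]
    have := Real.mul_self_sqrt hr.le
    field_simp
    nlinarith
  have hn : L < ((⌊L⌋₊ + 1 : ℕ) : ℝ) := by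
    push_cast
    exact Nat.lt_floor_add_one L
  gcongr
  have hb : (∫⁻ y in {y : X | r ≤ dist x y ∧ dist x y ≤ Real.sqrt r},
              ENNReal.ofReal (1 / dist x y ^ 2) ∂μ) ≤
      ENNReal.ofReal ((L + 1) * (C * Real.exp 1 ^ 2)) := by
    refine (lintegral_mono_set ?_).trans
      ((aux_sum μ x C hgrowth r hr (⌊L⌋₊ + 1)).trans ?_)
    · rintro y ⟨h1, h2⟩
      refine ⟨h1, h2.trans_lt ?_⟩
      rw [hs]
      gcongr
    · rw [← ENNReal.ofReal_natCast, ← ENNReal.ofReal_mul (by positivity)]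
      apply ENNReal.ofReal_le_ofReal
      push_cast
      gcongr
      exact Nat.floor_le hpos.le
  exact ENNReal.toReal_le_of_le_ofReal (by positivity) hb
end

section
/- Let X be a compact metric space and let μ and μ_k (k ∈ ℕ) be nonzero finite Borel measures on X such that μ_k → μ weakly, i.e. ∫ f dμ_k → ∫ f dμ for every continuous f : X → ℝ. Suppose there exist constants c > 0, n > 0 and ρ₀ > 0 such that for every k, every x ∈ supp μ_k and every ρ ∈ (0, ρ₀), one has μ_k(B̄(x, ρ)) ≥ c ρⁿ. Then the supports converge in Hausdorff distance: d_H(supp μ_k, supp μ) → 0 as k → ∞. -/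
open MeasureTheory Filter

/-- The (closed) support of a Borel measure on a metric space: the set of points all of
whose neighbourhoods have positive measure. -/
def measureSupport {X : Type*} [MetricSpace X] [MeasurableSpace X]
    (μ : Measure X) : Set X :=
  {x : X | ∀ ε : ℝ, 0 < ε → 0 < μ (Metric.ball x ε)}

theorem measureSupport_eq {X : Type*} [MetricSpace X] [MeasurableSpace X]
    (μ : Measure X) : measureSupport μ = μ.support := by
  ext x
  rw [Metric.nhds_basis_ball.mem_measureSupport]
  rfl

/-- If finite nonzero Borel measures `μs k` on a compact metric space converge weakly to
a nonzero measure `μ`, and all of them satisfy a uniform lower volume bound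
`μs k (B̄(x,ρ)) ≥ c ρⁿ` at points of their supports, then the supports converge to the
support of `μ` in Hausdorff distance. -/
theorem stmt_10 {X : Type*} [MetricSpace X] [CompactSpace X]
    [MeasurableSpace X] [BorelSpace X]
    (μ : Measure X) (μs : ℕ → Measure X)
    [IsFiniteMeasure μ] (hμfin : ∀ k, IsFiniteMeasure (μs k))
    (hμne : μ ≠ 0) (hμsne : ∀ k, μs k ≠ 0)
    (hweak : ∀ f : X → ℝ, Continuous f →
      Tendsto (fun k => ∫ x, f x ∂(μs k)) atTop (nhds (∫ x, f x ∂μ)))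
    (c n ρ₀ : ℝ) (hc : 0 < c) (hn : 0 < n) (hρ₀ : 0 < ρ₀)
    (hlower : ∀ k, ∀ x ∈ measureSupport (μs k), ∀ ρ : ℝ, 0 < ρ → ρ < ρ₀ →
      ENNReal.ofReal (c * ρ ^ n) ≤ μs k (Metric.closedBall x ρ)) :
    Tendsto (fun k => Metric.hausdorffDist (measureSupport (μs k)) (measureSupport μ))
      atTop (nhds 0) := by
  simp only [measureSupport_eq] at hlower ⊢
  have hSne : μ.support.Nonempty := Measure.nonempty_support hμne
  rw [Metric.tendsto_atTop']
  suffices H : ∀ r > 0, ∀ᶠ k in atTop,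
      Metric.hausdorffDist (μs k).support μ.support ≤ r by
    intro ε hε
    obtain ⟨N, hN⟩ := eventually_atTop.1 (H (ε / 2) (by positivity))
    refine ⟨N, fun k hk => ?_⟩
    rw [Real.dist_eq, sub_zero, abs_of_nonneg Metric.hausdorffDist_nonneg]
    linarith [hN k hk.le]
  intro r hr
  -- part 1
  have h1 : ∀ᶠ k in atTop, ∀ x ∈ (μs k).support, Metric.infDist x μ.support ≤ r := by
    have hcont : Continuous (fun x => Metric.infDist x μ.support) :=
      Metric.continuous_infDist_pt _
    have h0 : ∫ x, Metric.infDist x μ.support ∂μ = 0 := by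
      apply integral_eq_zero_of_ae
      filter_upwards [Measure.support_mem_ae (μ := μ)] with x hx
      exact Metric.infDist_zero_of_mem hx
    have hw := hweak _ hcont
    rw [h0] at hw
    obtain ⟨ρ, hρ, hρ1, hρ2⟩ : ∃ ρ : ℝ, 0 < ρ ∧ ρ < ρ₀ ∧ ρ ≤ r / 2 :=
      ⟨min (ρ₀ / 2) (r / 2), by positivity,
        (min_le_left _ _).trans_lt (by linarith), min_le_right _ _⟩
    have hpos : 0 < r / 2 * (c * ρ ^ n) := by positivity
    filter_upwards [hw.eventually_lt_const hpos] with k hk x hx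
    by_contra! hxr
    haveI := hμfin k
    have hint : Integrable (fun x => Metric.infDist x μ.support) (μs k) :=
      hcont.integrable_of_hasCompactSupport (HasCompactSupport.of_compactSpace _)
    have hb := mul_meas_ge_le_integral_of_nonneg
      (ae_of_all (μs k) fun x => Metric.infDist_nonneg (x := x) (s := μ.support)) hint (r / 2)
    have hl := hlower k x hx ρ hρ hρ1
    have hl2 : c * ρ ^ n ≤ (μs k).real {x | r / 2 ≤ Metric.infDist x μ.support} := by
      refine (ENNReal.ofReal_le_iff_le_toReal (measure_ne_top _ _)).1
        (hl.trans (measure_mono fun y hy => ?_))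
      have h3 := Metric.infDist_le_infDist_add_dist (s := μ.support) (x := x) (y := y)
      rw [Metric.mem_closedBall, dist_comm] at hy
      simp only [Set.mem_setOf_eq]
      linarith
    have := mul_le_mul_of_nonneg_left hl2 (by positivity : 0 ≤ r / 2)
    linarith
  -- part 2
  have h2 : ∀ᶠ k in atTop, ∀ x ∈ μ.support, Metric.infDist x (μs k).support ≤ r := by
    have hcpt : IsCompact μ.support := Measure.isClosed_support.isCompact
    obtain ⟨t, htS, htfin, hcov⟩ := hcpt.finite_cover_balls (half_pos hr)
    have hball : ∀ p ∈ t, ∀ᶠ k in atTop,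
        (Metric.ball p (r / 2) ∩ (μs k).support).Nonempty := by
      intro p hp
      have hcont : Continuous (fun y => max 0 (r / 2 - dist y p)) := by fun_prop
      have hint : Integrable (fun y => max 0 (r / 2 - dist y p)) μ :=
        hcont.integrable_of_hasCompactSupport (HasCompactSupport.of_compactSpace _)
      have hpos : 0 < ∫ y, max 0 (r / 2 - dist y p) ∂μ := by
        refine (integral_pos_iff_support_of_nonneg (f := fun y => max 0 (r / 2 - dist y p))
          (fun y => le_max_left _ _) hint).2 ?_
        have hps := (Measure.mem_support_iff_forall p).1 (htS hp) _
          (Metric.ball_mem_nhds p (half_pos hr))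
        refine hps.trans_le (measure_mono fun y hy => ?_)
        rw [Metric.mem_ball] at hy
        exact (lt_max_of_lt_right (by linarith)).ne'
      filter_upwards [(hweak _ hcont).eventually_const_lt hpos] with k hk
      apply Measure.nonempty_inter_support_of_pos
      rw [pos_iff_ne_zero]
      intro hz
      refine hk.ne' (integral_eq_zero_of_ae ?_)
      filter_upwards [measure_eq_zero_iff_ae_notMem.1 hz] with y hy
      rw [Metric.mem_ball, not_lt] at hy
      exact max_eq_left (by linarith)
    filter_upwards [(htfin.eventually_all).2 hball] with k hk x hx
    obtain ⟨p, hp, hxp⟩ := Set.mem_iUnion₂.1 (hcov hx)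
    obtain ⟨y, hy, hys⟩ := hk p hp
    refine (Metric.infDist_le_dist_of_mem hys).trans ?_
    rw [Metric.mem_ball] at hxp hy
    linarith [dist_triangle_right x y p]
  filter_upwards [h1, h2] with k hk1 hk2
  exact Metric.hausdorffDist_le_of_infDist hr.le hk1 hk2
end
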